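/- arXiv:2601.20414 — 2 statements merged into one kernel-verified Lean document; each statement's English description precedes it below -/
import Mathlib

section
/- A gauge function is a function $f:[0,\infty)\to[0,\infty)$ that is nondecreasing, right-continuous and satisfies $f(0)=0$. For a metric space $(X,d)$, a gauge function $f$ and $A\subseteq X$, the $f$-Hausdorff measure of $A$ is $$\mathcal H^f(A)=\sup_{\delta>0}\ \inf\Big\{\sum_{n\in\omega} f(\operatorname{diam} C_n) : A\subseteq\bigcup_{n} C_n,\ \operatorname{diam} C_n\le\delta \text{ for all } n\Big\},$$ and $\mathcal N^f_X=\{A\subseteq X:\mathcal H^f(A)=0\}$. Let $(X,d)$ be a separable metric space and $f$ a gauge function satisfying Assumption($*$): there exist a constant $\alpha>1$ and a countable family $\mathcal C$ of subsets of $X$ such that for every $A\subseteq X$ of finite diameter and every $\varepsilon>0$ there is $C\in\mathcal C$ of finite diameter with $A\subseteq C$ and $f(\operatorname{diam} C)\le\varepsilon+\alpha f(\operatorname{diam} A)$. Let $\mathcal N$ be the ideal of null subsets of Cantor space $2^\omega$ with respect to the uniform (coin-flipping) product probability measure. Then $\mathcal N^f_X$ is Tukey reducible to $\mathcal N$, that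 is, there are maps $\varphi:\mathcal N^f_X\to\mathcal N$ and $\psi:\mathcal N\to\mathcal N^f_X$ such that $\varphi(A)\subseteq B$ implies $A\subseteq\psi(B)$ for all $A\in\mathcal N^f_X$ and $B\in\mathcal N$. In particular, $$\operatorname{add}(\mathcal N)\le\operatorname{add}(\mathcal N^f_X)\quad\text{and}\quad \operatorname{cof}(\mathcal N^f_X)\le\operatorname{cof}(\mathcal N).$$ Here, for an ideal $\mathcal I$, $\operatorname{add}(\mathcal I)$ is the least cardinality of a family $F\subseteq\mathcal I$ with $\bigcup F\notin\mathcal I$, and $\operatorname{add}(\mathcal I)=\infty$ (larger than every cardinal) if there is no such family, which for $\mathcal N^f_X$ happens exactly when $\mathcal H^f(X)=0$; $\operatorname{cof}(\mathcal I)$ is the least cardinality of a family $F\subseteq\mathcal I$ such that every $A\in\mathcal I$ is contained in some member of $F$. -/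
open scoped NNReal ENNReal Cardinal

universe u v

/-- A gauge function `f : [0, ∞) → [0, ∞)`: nondecreasing, right-continuous, with `f 0 = 0`. -/
structure IsGauge (f : ℝ≥0 → ℝ≥0) : Prop where
  map_zero : f 0 = 0
  mono : Monotone f
  rightCont : ∀ x : ℝ≥0, ContinuousWithinAt f (Set.Ici x) x

/-- Assumption(*) for a metric space `X` and a gauge function `f`. Since `f` is defined on finite
values only, `f (diam C)` presupposes that the diameter of `C` is finite. -/
def AssumptionStar (X : Type u) [MetricSpace X] (f : ℝ≥0 → ℝ≥0) : Prop :=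
  ∃ α : ℝ≥0, 1 < α ∧ ∃ 𝒞 : Set (Set X), 𝒞.Countable ∧
    ∀ A : Set X, Metric.ediam A ≠ ⊤ → ∀ ε : ℝ≥0, 0 < ε →
      ∃ C ∈ 𝒞, A ⊆ C ∧ Metric.ediam C ≠ ⊤ ∧
        f (Metric.ediam C).toNNReal ≤ ε + α * f (Metric.ediam A).toNNReal

/-- The `δ`-approximation of the `f`-Hausdorff measure: the infimum of `∑ f (diam (C n))` over all
sequences `C` of sets of diameter at most `δ` that cover `A` (it is `∞` if there is none). -/
noncomputable def gaugeHausdorffApprox {X : Type u} [MetricSpace X] (f : ℝ≥0 → ℝ≥0) (δ : ℝ≥0)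
    (A : Set X) : ℝ≥0∞ :=
  ⨅ (C : ℕ → Set X) (_ : A ⊆ ⋃ n, C n) (_ : ∀ n, Metric.ediam (C n) ≤ (δ : ℝ≥0∞)),
    ∑' n, (f (Metric.ediam (C n)).toNNReal : ℝ≥0∞)

/-- The `f`-Hausdorff measure, an outer measure defined on all subsets of `X`. -/
noncomputable def gaugeHausdorff {X : Type u} [MetricSpace X] (f : ℝ≥0 → ℝ≥0)
    (A : Set X) : ℝ≥0∞ :=
  ⨆ (δ : ℝ≥0) (_ : 0 < δ), gaugeHausdorffApprox f δ A

/-- The family of `f`-Hausdorff null subsets of `X`. -/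
def gaugeNull (X : Type u) [MetricSpace X] (f : ℝ≥0 → ℝ≥0) : Set (Set X) :=
  {A | gaugeHausdorff f A = 0}

/-- The fair coin-flipping product probability measure on Cantor space. -/
noncomputable def coinMeasure : MeasureTheory.Measure (ℕ → Bool) :=
  MeasureTheory.Measure.infinitePi fun _ : ℕ => (PMF.uniformOfFintype Bool).toMeasure

/-- The ideal of null subsets of Cantor space (not necessarily measurable sets: a measure
is extended to all sets as an outer measure). -/
def cantorNull : Set (Set (ℕ → Bool)) :=
  {A | coinMeasure A = 0}

/-- The additivity of `I`: the least cardinality of a subfamily of `I` whose union is not in `I`,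
with value `∞ = ⊤` if there is no such subfamily (that is, if `I` is closed under all unions;
for instance if `I` consists of all subsets). -/
noncomputable def addIdeal {α : Type u} (I : Set (Set α)) : WithTop Cardinal.{u} :=
  ⨅ (F : Set (Set α)) (_ : F ⊆ I) (_ : ⋃₀ F ∉ I), ((#F : Cardinal.{u}) : WithTop Cardinal.{u})

/-- The cofinality of `I`: the least cardinality of a subfamily `F` of `I` such that every member
of `I` is contained in a member of `F`. The set below is never empty, as it contains `#I`. -/
noncomputable def cofIdeal {α : Type u} (I : Set (Set α)) : Cardinal.{u} :=
  sInf {c | ∃ F : Set (Set α), F ⊆ I ∧ (∀ A ∈ I, ∃ B ∈ F, A ⊆ B) ∧ c = #F}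

/-- Tukey reducibility of families of sets ordered by inclusion. -/
def TukeyLE {α : Type u} {β : Type v} (I : Set (Set α)) (J : Set (Set β)) : Prop :=
  ∃ (φ : I → J) (ψ : J → I), ∀ (A : I) (B : J),
    (φ A : Set β) ⊆ (B : Set β) → (A : Set α) ⊆ (ψ B : Set α)

open MeasureTheory ProbabilityTheory Filter Topology

/-! ### Independent open sets and null sets -/

/-- If the complements of independent sets `G n`, `n ∈ S`, all contain a fixed set of positive
measure, then the measures of the `G n`, `n ∈ S`, are summable. -/
lemma tsum_measure_ne_top_of_iIndepSet {Ω : Type*} [MeasurableSpace Ω] {μ : Measure Ω}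
    [IsProbabilityMeasure μ] {G : ℕ → Set Ω} (hGm : ∀ n, MeasurableSet (G n))
    (hG : iIndepSet G μ) {S : Set ℕ} {P : Set Ω} (hP : μ P ≠ 0)
    (hPG : ∀ n ∈ S, Disjoint P (G n)) : ∑' n : S, μ (G n) ≠ ⊤ := by
  have hc : 0 < μ.real P := ENNReal.toReal_pos hP (measure_ne_top _ _)
  have key : ∀ T : Finset S, ∑ n ∈ T, μ.real (G n) ≤ -Real.log (μ.real P) := by
    intro T
    have hind : μ (⋂ n ∈ T.map (Function.Embedding.subtype _), (G n)ᶜ)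
        = ∏ n ∈ T.map (Function.Embedding.subtype _), μ (G n)ᶜ := by
      refine (iIndepSet_iff G μ).1 hG _ (f := fun n => (G n)ᶜ) fun n _ => ?_
      exact (MeasurableSpace.measurableSet_generateFrom (Set.mem_singleton _)).compl
    have hsub : P ⊆ ⋂ n ∈ T.map (Function.Embedding.subtype _), (G n)ᶜ := by
      intro x hx
      simp only [Set.mem_iInter, Finset.mem_map]
      rintro n ⟨m, -, rfl⟩
      exact Set.disjoint_left.1 (hPG m m.2) hx
    have h1 : μ.real P ≤ ∏ n ∈ T, (1 - μ.real (G n)) := by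
      have := measureReal_mono (μ := μ) hsub
      rw [measureReal_def _ (⋂ n ∈ _, _), hind, ENNReal.toReal_prod, Finset.prod_map] at this
      refine this.trans_eq (Finset.prod_congr rfl fun n _ => ?_)
      exact probReal_compl_eq_one_sub (hGm n)
    have h2 : ∏ n ∈ T, (1 - μ.real (G n)) ≤ Real.exp (-∑ n ∈ T, μ.real (G n)) := by
      rw [← Finset.sum_neg_distrib, Real.exp_sum]
      refine Finset.prod_le_prod (fun n _ => ?_) fun n _ => ?_
      · linarith [measureReal_le_one (μ := μ) (s := G n)]
      · linarith [Real.add_one_le_exp (-μ.real (G n))]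
    have h3 := Real.log_le_log hc (h1.trans h2)
    rw [Real.log_exp] at h3
    linarith
  have : Summable fun n : S => μ.real (G n) :=
    summable_of_sum_le (fun _ => measureReal_nonneg) key
  have h := this.tsum_ofReal_ne_top
  simpa using h

/-- For independent open sets `G n`, a null set `B` determines countably many sets `S` of indices
along which the measures of the `G n` are summable, such that every `E` for which `B` contains
the upper limit of the `G n`, `n ∈ E`, is almost contained in one of these. -/
lemma exists_countable_summable_of_measure_eq_zero {Ω : Type*} [TopologicalSpace Ω] [T2Space Ω]
    [SecondCountableTopology Ω] [MeasurableSpace Ω] [BorelSpace Ω] {μ : Measure Ω}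
    [IsProbabilityMeasure μ] [μ.InnerRegular] {G : ℕ → Set Ω} (hGo : ∀ n, IsOpen (G n))
    (hG : iIndepSet G μ) {B : Set Ω} (hB : μ B = 0) :
    ∃ 𝒮 : Set (Set ℕ), 𝒮.Countable ∧
      (∀ S ∈ 𝒮, ∑' n : S, μ (G n) ≠ ⊤ ∧ ∀ n ∈ S, G n ≠ Set.univ) ∧
      ∀ E : Set ℕ, {x | ∃ᶠ n in atTop, n ∈ E ∧ x ∈ G n} ⊆ B →
        ∃ S ∈ 𝒮, ∀ᶠ n in atTop, n ∈ E → n ∈ S := by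
  have hpos : 0 < μ (toMeasurable μ B)ᶜ := by
    rw [prob_compl_eq_one_sub (measurableSet_toMeasurable _ _), measure_toMeasurable, hB]
    simp
  obtain ⟨K₀, hK₀B, hK₀, hK₀pos⟩ :=
    (measurableSet_toMeasurable μ B).compl.exists_lt_isCompact hpos
  set K := (μ.restrict K₀).support with hKdef
  have hKK₀ : K ⊆ K₀ := Measure.support_subset_of_isClosed hK₀.isClosed
    (ae_restrict_mem hK₀.measurableSet)
  have hK : IsCompact K := hK₀.of_isClosed_subset Measure.isClosed_support hKK₀
  have hKne : K.Nonempty := Measure.nonempty_support (by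
    rw [Ne, Measure.restrict_eq_zero]; exact hK₀pos.ne')
  have hKB : Disjoint K B := Set.disjoint_left.2 fun x hx hxB =>
    hK₀B (hKK₀ hx) (subset_toMeasurable μ B hxB)
  have hKU : ∀ U, IsOpen U → (U ∩ K).Nonempty → μ (U ∩ K) ≠ 0 := by
    rintro U hU ⟨x, hxU, hxK⟩ h0
    have h1 : 0 < μ.restrict K₀ U :=
      (Measure.mem_support_iff_forall x).1 hxK U (hU.mem_nhds hxU)
    have h2 : μ.restrict K₀ U ≤ μ.restrict K₀ (U ∩ K) + μ.restrict K₀ Kᶜ :=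
      (measure_mono (fun y hy => by
        by_cases h : y ∈ K
        · exact Or.inl ⟨hy, h⟩
        · exact Or.inr h)).trans (measure_union_le _ _)
    have h3 : μ.restrict K₀ (U ∩ K) = 0 :=
      le_antisymm ((Measure.restrict_apply_le _ _).trans h0.le) bot_le
    rw [h3, Measure.measure_compl_support, add_zero] at h2
    exact h1.not_ge h2
  refine ⟨(fun U => {n | Disjoint (U ∩ K) (G n)}) ''
    {U ∈ TopologicalSpace.countableBasis Ω | (U ∩ K).Nonempty},
    ((TopologicalSpace.countable_countableBasis Ω).mono fun _ h => h.1).image _, ?_, ?_⟩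
  · rintro _ ⟨U, ⟨hUb, hUK⟩, rfl⟩
    refine ⟨tsum_measure_ne_top_of_iIndepSet (fun n => (hGo n).measurableSet) hG
      (hKU U (TopologicalSpace.isOpen_of_mem_countableBasis hUb) hUK) fun n hn => hn, ?_⟩
    intro n hn h
    have hn' : Disjoint (U ∩ K) (G n) := hn
    rw [h, Set.disjoint_univ] at hn'
    exact hUK.ne_empty hn'
  · intro E hE
    by_contra hcon
    have : CompactSpace K := isCompact_iff_compactSpace.1 hK
    have : Nonempty K := hKne.to_subtype
    have hd : Dense (⋂ m : ℕ, ⋃ n ∈ {n | n ∈ E ∧ m ≤ n}, ((↑) : K → Ω) ⁻¹' G n) := by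
      refine dense_iInter_of_isOpen_nat (fun m => isOpen_biUnion fun n _ =>
        (hGo n).preimage continuous_subtype_val) fun m => ?_
      rw [dense_iff_inter_open]
      rintro V hV ⟨x, hxV⟩
      obtain ⟨V', hV', rfl⟩ := isOpen_induced_iff.1 hV
      obtain ⟨U, hUb, hxU, hUV⟩ :=
        (TopologicalSpace.isBasis_countableBasis Ω).exists_subset_of_mem_open hxV hV'
      have h : ¬∀ᶠ n in atTop, n ∈ E → Disjoint (U ∩ K) (G n) := fun hev =>
        hcon ⟨_, ⟨U, ⟨hUb, x, hxU, x.2⟩, rfl⟩, hev⟩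
      obtain ⟨n, hmn, hn⟩ := frequently_atTop.1 (not_eventually.1 h) m
      obtain ⟨hnE, hn⟩ := Classical.not_imp.1 hn
      obtain ⟨y, ⟨hyU, hyK⟩, hyG⟩ := Set.not_disjoint_iff.1 hn
      exact ⟨⟨y, hyK⟩, hUV hyU, Set.mem_biUnion (x := n) ⟨hnE, hmn⟩ hyG⟩
    obtain ⟨x, hx⟩ := hd.nonempty
    refine Set.disjoint_left.1 hKB x.2 (hE ?_)
    refine frequently_atTop.2 fun m => ?_
    obtain ⟨n, ⟨hnE, hmn⟩, hn⟩ := Set.mem_iUnion₂.1 (Set.mem_iInter.1 hx m)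
    exact ⟨n, hmn, hnE, hn⟩

/-! ### Independent clopen sets in Cantor space -/

instance : IsProbabilityMeasure coinMeasure := by
  unfold coinMeasure
  infer_instance

/-- The set of points of Cantor space whose first `k` coordinates in the `n`-th row (with respect
to the pairing function) are all `true`. -/
def cantorRow (n k : ℕ) : Set (ℕ → Bool) :=
  {x | ∀ i < k, x (Nat.pair n i) = true}

lemma cantorRow_zero (n : ℕ) : cantorRow n 0 = Set.univ := by
  simp [cantorRow]

lemma isOpen_cantorRow (n k : ℕ) : IsOpen (cantorRow n k) := by
  have : cantorRow n k = ⋂ i ∈ Finset.range k, {x | x (Nat.pair n i) = true} := by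
    ext x; simp [cantorRow]
  rw [this]
  exact isOpen_biInter_finset fun i _ =>
    (isOpen_discrete ({true} : Set Bool)).preimage
      (continuous_apply (A := fun _ : ℕ => Bool) (Nat.pair n i))

lemma coinMeasure_biInter_cantorRow (k : ℕ → ℕ) (T : Finset ℕ) :
    coinMeasure (⋂ n ∈ T, cantorRow n (k n)) = ∏ n ∈ T, (2⁻¹ : ℝ≥0∞) ^ k n := by
  classical
  have hset : (⋂ n ∈ T, cantorRow n (k n)) =
      Set.pi (((T.sigma fun n => Finset.range (k n)).image fun p => Nat.pair p.1 p.2 :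
        Finset ℕ) : Set ℕ) fun _ => {true} := by
    ext x
    simp only [cantorRow, Set.mem_iInter, Set.mem_pi, Finset.coe_image, Set.mem_image,
      Set.mem_singleton_iff]
    constructor
    · rintro h _ ⟨p, hp, rfl⟩
      simp only [Finset.mem_coe, Finset.mem_sigma, Finset.mem_range] at hp
      exact h _ hp.1 _ hp.2
    · intro h n hn i hi
      exact h _ ⟨⟨n, i⟩, by simp [hn, hi], rfl⟩
  rw [hset, coinMeasure, Measure.infinitePi_pi _ (fun _ _ => measurableSet_singleton _),
    Finset.prod_image, Finset.prod_sigma]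
  · simp
  · rintro ⟨a, b⟩ - ⟨c, d⟩ - h
    obtain ⟨rfl, rfl⟩ := Nat.pair_eq_pair.1 h
    rfl

lemma coinMeasure_cantorRow (n k : ℕ) : coinMeasure (cantorRow n k) = 2⁻¹ ^ k := by
  simpa using coinMeasure_biInter_cantorRow (fun _ => k) {n}

lemma iIndepSet_cantorRow (k : ℕ → ℕ) :
    iIndepSet (fun n => cantorRow n (k n)) coinMeasure := by
  rw [iIndepSet_iff_meas_biInter fun n => (isOpen_cantorRow n (k n)).measurableSet]
  intro T
  simp only [coinMeasure_biInter_cantorRow, coinMeasure_cantorRow]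

/-! ### Cardinal invariants and Tukey reductions -/

lemma TukeyLE.addIdeal_le {α : Type u} {β : Type} {I : Set (Set α)} {J : Set (Set β)}
    (h : TukeyLE I J) (hI : ∀ A B, A ⊆ B → B ∈ I → A ∈ I) :
    WithTop.map Cardinal.lift.{u, 0} (addIdeal J) ≤ addIdeal I := by
  obtain ⟨φ, ψ, hφψ⟩ := h
  refine le_iInf fun F => le_iInf fun hF => le_iInf fun hFI => ?_
  let g : F → Set β := fun A => φ ⟨A, hF A.2⟩
  have hgJ : Set.range g ⊆ J := by
    rintro _ ⟨A, rfl⟩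
    exact (φ _).2
  have hgU : ⋃₀ Set.range g ∉ J := fun hmem => hFI <| hI _ _ (Set.sUnion_subset fun A hA =>
    hφψ ⟨A, hF hA⟩ ⟨_, hmem⟩ (Set.subset_sUnion_of_mem ⟨⟨A, hA⟩, rfl⟩)) (ψ ⟨_, hmem⟩).2
  have h1 : addIdeal J ≤ ((#(Set.range g) : Cardinal.{0}) : WithTop Cardinal.{0}) :=
    iInf_le_of_le _ (iInf_le_of_le hgJ (iInf_le_of_le hgU le_rfl))
  have hmono : Monotone Cardinal.lift.{u, 0} := fun _ _ h => Cardinal.lift_le.2 h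
  refine (hmono.withTop_map h1).trans ?_
  rw [WithTop.map_coe, WithTop.coe_le_coe]
  simpa using Cardinal.mk_range_le_lift (f := g)

lemma TukeyLE.cofIdeal_le {α : Type u} {β : Type} {I : Set (Set α)} {J : Set (Set β)}
    (h : TukeyLE I J) : cofIdeal I ≤ Cardinal.lift.{u, 0} (cofIdeal J) := by
  obtain ⟨φ, ψ, hφψ⟩ := h
  obtain ⟨F, hF, hFc, hcard⟩ := csInf_mem (s := {c | ∃ F : Set (Set β), F ⊆ J ∧
    (∀ A ∈ J, ∃ B ∈ F, A ⊆ B) ∧ c = #F}) ⟨_, J, subset_rfl, fun A hA => ⟨A, hA, subset_rfl⟩, rfl⟩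
  let g : F → Set α := fun B => ψ ⟨B, hF B.2⟩
  have h1 : cofIdeal I ≤ #(Set.range g) := by
    refine csInf_le' ⟨Set.range g, ?_, fun A hA => ?_, rfl⟩
    · rintro _ ⟨B, rfl⟩
      exact (ψ _).2
    · obtain ⟨B, hB, hAB⟩ := hFc (φ ⟨A, hA⟩) (φ _).2
      exact ⟨_, ⟨⟨B, hB⟩, rfl⟩, hφψ ⟨A, hA⟩ ⟨B, hF hB⟩ hAB⟩
  refine h1.trans ?_
  rw [cofIdeal, hcard]
  simpa using Cardinal.mk_range_le_lift (f := g)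
/-! ### Null sets of gauge Hausdorff measures -/

section GaugeNull

variable {X : Type u} [MetricSpace X] {f : ℝ≥0 → ℝ≥0}

lemma mem_gaugeNull_iff {A : Set X} : A ∈ gaugeNull X f ↔
    ∀ δ : ℝ≥0, 0 < δ → ∀ ε : ℝ≥0∞, 0 < ε → ∃ C : ℕ → Set X, A ⊆ ⋃ n, C n ∧
      (∀ n, Metric.ediam (C n) ≤ (δ : ℝ≥0∞)) ∧
      ∑' n, (f (Metric.ediam (C n)).toNNReal : ℝ≥0∞) < ε := by
  have h0 : A ∈ gaugeNull X f ↔ ∀ δ : ℝ≥0, 0 < δ → gaugeHausdorffApprox f δ A = 0 := by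
    change gaugeHausdorff f A = 0 ↔ _
    simp [gaugeHausdorff]
  rw [h0]
  refine forall₂_congr fun δ _ => ?_
  constructor
  · intro h ε hε
    rw [← h, gaugeHausdorffApprox] at hε
    simpa only [iInf_lt_iff, exists_prop] using hε
  · intro h
    refine le_antisymm (le_of_forall_gt fun ε hε => ?_) bot_le
    rw [gaugeHausdorffApprox]
    simpa only [iInf_lt_iff, exists_prop] using h ε hε

lemma gaugeNull_mono {A B : Set X} (h : A ⊆ B) (hB : B ∈ gaugeNull X f) : A ∈ gaugeNull X f := by
  rw [mem_gaugeNull_iff] at hB ⊢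
  intro δ hδ ε hε
  obtain ⟨C, hC, hC'⟩ := hB δ hδ ε hε
  exact ⟨C, h.trans hC, hC'⟩

lemma iUnion_mem_gaugeNull {A : ℕ → Set X} (hA : ∀ j, A j ∈ gaugeNull X f) :
    ⋃ j, A j ∈ gaugeNull X f := by
  rw [mem_gaugeNull_iff]
  intro δ hδ ε hε
  obtain ⟨ε', hε', hsum⟩ := ENNReal.exists_pos_sum_of_countable hε.ne' ℕ
  choose C hAC hCδ hCε using fun j => mem_gaugeNull_iff.1 (hA j) δ hδ (ε' j)
    (ENNReal.coe_pos.2 (hε' j))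
  refine ⟨fun n => C n.unpair.1 n.unpair.2, ?_, fun n => hCδ _ _, ?_⟩
  · refine Set.iUnion_subset fun j x hx => ?_
    obtain ⟨i, hi⟩ := Set.mem_iUnion.1 (hAC j hx)
    exact Set.mem_iUnion.2 ⟨Nat.pair j i, by simpa using hi⟩
  · have := Nat.pairEquiv.symm.tsum_eq
      fun p : ℕ × ℕ => (f (Metric.ediam (C p.1 p.2)).toNNReal : ℝ≥0∞)
    change ∑' n : ℕ, (f (Metric.ediam (C n.unpair.1 n.unpair.2)).toNNReal : ℝ≥0∞) = _ at this
    rw [this, ENNReal.tsum_prod (f := fun j i => (f (Metric.ediam (C j i)).toNNReal : ℝ≥0∞))]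
    exact (ENNReal.tsum_le_tsum fun j => (hCε j).le).trans_lt hsum

lemma biUnion_mem_gaugeNull (hf : IsGauge f) {ι : Type*} {s : Set ι} (hs : s.Countable)
    {A : ι → Set X} (hA : ∀ i ∈ s, A i ∈ gaugeNull X f) : ⋃ i ∈ s, A i ∈ gaugeNull X f := by
  rcases s.eq_empty_or_nonempty with rfl | hne
  · rw [mem_gaugeNull_iff]
    intro δ _ ε hε
    exact ⟨fun _ => ∅, by simp, by simp, by simpa [hf.map_zero] using hε⟩
  · obtain ⟨e, rfl⟩ := hs.exists_eq_range hne
    rw [Set.biUnion_range]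
    exact iUnion_mem_gaugeNull fun j => hA _ ⟨j, rfl⟩

/-- If a gauge function vanishes at a positive point, then all sets are null. -/
lemma univ_mem_gaugeNull [TopologicalSpace.SeparableSpace X] (hf : IsGauge f) {r : ℝ≥0}
    (hr : 0 < r) (hfr : f r = 0) : (Set.univ : Set X) ∈ gaugeNull X f := by
  rw [mem_gaugeNull_iff]
  intro δ hδ ε hε
  rcases isEmpty_or_nonempty X with hX | hX
  · exact ⟨fun _ => ∅, by simp [Set.univ_eq_empty_iff.2 hX], by simp,
      by simpa [hf.map_zero] using hε⟩
  set ρ : ℝ≥0 := min δ r / 2 with hρ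
  have hρ0 : 0 < ρ := half_pos (lt_min hδ hr)
  have hdiam : ∀ x : X, Metric.ediam (Metric.eball x (ρ : ℝ≥0∞)) ≤ (min δ r : ℝ≥0) := fun x => by
    refine Metric.ediam_eball_le.trans_eq ?_
    rw [← ENNReal.coe_ofNat, ← ENNReal.coe_mul, hρ, mul_div_cancel₀ _ two_ne_zero]
  refine ⟨fun n => Metric.eball (TopologicalSpace.denseSeq X n) ρ, ?_, ?_, ?_⟩
  · intro x _
    obtain ⟨n, hn⟩ := (TopologicalSpace.denseRange_denseSeq X).exists_mem_open
      (Metric.isOpen_eball (x := x) (ε := (ρ : ℝ≥0∞))) 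
      ⟨x, Metric.mem_eball_self (by simpa using hρ0)⟩
    exact Set.mem_iUnion.2 ⟨n, Metric.mem_eball_comm.1 hn⟩
  · exact fun n => (hdiam _).trans (ENNReal.coe_le_coe.2 (min_le_left _ _))
  · have : ∀ n, f (Metric.ediam (Metric.eball (TopologicalSpace.denseSeq X n) ρ)).toNNReal = 0 := by
      intro n
      refine le_antisymm ((hf.mono ?_).trans hfr.le) bot_le
      refine (ENNReal.toNNReal_mono ENNReal.coe_ne_top (hdiam _)).trans ?_
      rw [ENNReal.toNNReal_coe]
      exact min_le_right _ _
    simp only [this, ENNReal.coe_zero, tsum_zero, hε]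

/-- The upper limit of a sequence of sets with a finite sum of gauge values is null. -/
lemma setOf_frequently_mem_gaugeNull (hf : IsGauge f) (hpos : ∀ r, 0 < r → 0 < f r)
    {D : ℕ → Set X} (hD : ∀ n, Metric.ediam (D n) ≠ ⊤)
    (hsum : ∑' n, (f (Metric.ediam (D n)).toNNReal : ℝ≥0∞) ≠ ⊤) :
    {x | ∃ᶠ n in atTop, x ∈ D n} ∈ gaugeNull X f := by
  rw [mem_gaugeNull_iff]
  intro δ hδ ε hε
  have ht := ENNReal.tendsto_sum_nat_add _ hsum
  have hm : 0 < min ε (f δ : ℝ≥0∞) := lt_min hε (ENNReal.coe_pos.2 (hpos δ hδ))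
  obtain ⟨m, hm⟩ := (ht.eventually_lt_const hm).exists
  refine ⟨fun n => D (n + m), fun x hx => ?_, fun n => ?_, hm.trans_le (min_le_left _ _)⟩
  · obtain ⟨n, hmn, hn⟩ := frequently_atTop.1 hx m
    exact Set.mem_iUnion.2 ⟨n - m, by rwa [Nat.sub_add_cancel hmn]⟩
  · have h1 : (f (Metric.ediam (D (n + m))).toNNReal : ℝ≥0∞) < f δ :=
      (ENNReal.le_tsum n).trans_lt (hm.trans_le (min_le_right _ _))
    have h2 := (hf.mono.reflect_lt (ENNReal.coe_lt_coe.1 h1)).le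
    rwa [← ENNReal.coe_toNNReal (hD (n + m)), ENNReal.coe_le_coe]

/-- The upper limit of `C n`, `n ∈ S`, is null if the gauge values are summable along `S`. -/
lemma setOf_frequently_mem_and_mem_gaugeNull (hf : IsGauge f) (hpos : ∀ r, 0 < r → 0 < f r)
    {C : ℕ → Set X} (hC : ∀ n, Metric.ediam (C n) ≠ ⊤) {S : Set ℕ}
    (hsum : ∑' n : S, (f (Metric.ediam (C n)).toNNReal : ℝ≥0∞) ≠ ⊤) :
    {x | ∃ᶠ n in atTop, n ∈ S ∧ x ∈ C n} ∈ gaugeNull X f := by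
  classical
  have h := setOf_frequently_mem_gaugeNull (D := fun n => if n ∈ S then C n else ∅) hf hpos
    (fun n => by split_ifs <;> simp [hC]) ?_
  · refine gaugeNull_mono (fun x hx => ?_) h
    exact Frequently.mono hx fun n hn => by simpa [hn.1] using hn.2
  · rw [tsum_subtype S fun n => (f (Metric.ediam (C n)).toNNReal : ℝ≥0∞)] at hsum
    convert hsum using 3 with n
    by_cases hn : n ∈ S <;> simp [hn, hf.map_zero]

/-- A null set is covered by the members of gauge value zero of a suitable countable family `C`
and the upper limit of a subfamily with a finite sum of gauge values. -/
lemma exists_subset_frequently_of_mem_gaugeNull {α : ℝ≥0} {C : ℕ → Set X}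
    (hC : ∀ A : Set X, Metric.ediam A ≠ ⊤ → ∀ ε : ℝ≥0, 0 < ε → ∃ n, A ⊆ C n ∧
      f (Metric.ediam (C n)).toNNReal ≤ ε + α * f (Metric.ediam A).toNNReal)
    {A : Set X} (hA : A ∈ gaugeNull X f) :
    ∃ E : Set ℕ, ∑' n : E, (f (Metric.ediam (C n)).toNNReal : ℝ≥0∞) ≠ ⊤ ∧
      ∀ x ∈ A, (∃ n, f (Metric.ediam (C n)).toNNReal = 0 ∧ x ∈ C n) ∨
        ∃ᶠ n in atTop, n ∈ E ∧ x ∈ C n := by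
  obtain ⟨η, hη, hηsum⟩ := ENNReal.exists_pos_sum_of_countable (one_ne_zero (α := ℝ≥0∞)) (ℕ × ℕ)
  obtain ⟨ε, hε, hεsum⟩ := ENNReal.exists_pos_sum_of_countable (one_ne_zero (α := ℝ≥0∞)) ℕ
  choose D hAD hDd hDs using fun k => mem_gaugeNull_iff.1 hA 1 one_pos (ε k)
    (ENNReal.coe_pos.2 (hε k))
  have hDfin : ∀ k i, Metric.ediam (D k i) ≠ ⊤ := fun k i =>
    ((hDd k i).trans_lt ENNReal.coe_lt_top).ne
  choose e hDe he using fun p : ℕ × ℕ => hC (D p.1 p.2) (hDfin _ _) (η p) (hη p)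
  have hsum : ∑' p, (f (Metric.ediam (C (e p))).toNNReal : ℝ≥0∞) ≠ ⊤ := by
    have h1 : ∑' p, (f (Metric.ediam (C (e p))).toNNReal : ℝ≥0∞) ≤
        ∑' p, (η p : ℝ≥0∞) + α * ∑' p : ℕ × ℕ, (f (Metric.ediam (D p.1 p.2)).toNNReal : ℝ≥0∞) := by
      rw [← ENNReal.tsum_mul_left, ← ENNReal.tsum_add]
      exact ENNReal.tsum_le_tsum fun p => by exact_mod_cast he p
    have h2 : ∑' p : ℕ × ℕ, (f (Metric.ediam (D p.1 p.2)).toNNReal : ℝ≥0∞) ≤ 1 := by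
      rw [ENNReal.tsum_prod (f := fun k i => (f (Metric.ediam (D k i)).toNNReal : ℝ≥0∞))]
      exact (ENNReal.tsum_le_tsum fun k => (hDs k).le).trans hεsum.le
    refine (h1.trans_lt (ENNReal.add_lt_top.2 ⟨hηsum.trans ENNReal.one_lt_top,
      ENNReal.mul_lt_top ENNReal.coe_lt_top (h2.trans_lt ENNReal.one_lt_top)⟩)).ne
  refine ⟨Set.range e, ?_, fun x hx => ?_⟩
  · refine ne_top_of_le_ne_top hsum ?_
    have := ENNReal.tsum_comp_le_tsum_of_injective (Set.rangeSplitting_injective e)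
      fun p => (f (Metric.ediam (C (e p))).toNNReal : ℝ≥0∞)
    simpa only [Set.apply_rangeSplitting] using this
  · by_contra! hcon
    obtain ⟨hne, hfin⟩ := hcon
    obtain ⟨N, hN⟩ := eventually_atTop.1 hfin
    choose i hi using fun k => Set.mem_iUnion.1 (hAD k hx)
    have hxC : ∀ k, x ∈ C (e (k, i k)) := fun k => hDe (k, i k) (hi k)
    have hlt : ∀ k, e (k, i k) < N := fun k => by
      by_contra! h
      exact hN _ h ⟨_, rfl⟩ (hxC k)
    have hinj : Function.Injective fun k => (k, i k) := fun a b h => (Prod.ext_iff.1 h).1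
    have hsum' : ∑' k, (f (Metric.ediam (C (e (k, i k)))).toNNReal : ℝ≥0∞) ≠ ⊤ :=
      ne_top_of_le_ne_top hsum (ENNReal.tsum_comp_le_tsum_of_injective hinj
        fun p => (f (Metric.ediam (C (e p))).toNNReal : ℝ≥0∞))
    have ht := ENNReal.tendsto_atTop_zero_of_tsum_ne_top hsum'
    have hev : ∀ n ∈ Finset.range N, ∀ᶠ k in atTop, e (k, i k) ≠ n := by
      intro n _
      by_cases hn : x ∈ C n
      · have h0 : (0 : ℝ≥0∞) < f (Metric.ediam (C n)).toNNReal :=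
          ENNReal.coe_pos.2 (pos_iff_ne_zero.2 fun h => hne n h hn)
        filter_upwards [ht.eventually_lt_const h0] with k hk h
        rw [h] at hk
        exact hk.false
      · exact Eventually.of_forall fun k h => hn (h ▸ hxC k)
    obtain ⟨k, hk⟩ := ((Filter.eventually_all_finset _).2 hev).exists
    exact hk _ (Finset.mem_range.2 (hlt k)) rfl

end GaugeNull

/-- Every nonnegative sequence is comparable to a sequence of powers of `1 / 2`, up to a summable
error. -/
lemma exists_pow_half_comparable (a : ℕ → ℝ≥0) : ∃ k : ℕ → ℕ,
    (∀ n, (2⁻¹ : ℝ≥0∞) ^ k n ≤ a n + 2⁻¹ ^ n) ∧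
      ∀ n, k n ≠ 0 → (a n : ℝ≥0∞) ≤ 2 * 2⁻¹ ^ k n := by
  classical
  have hex : ∀ n, ∃ k : ℕ, (2⁻¹ : ℝ≥0∞) ^ k ≤ a n + 2⁻¹ ^ n := fun n => ⟨n, le_add_self⟩
  refine ⟨fun n => Nat.find (hex n), fun n => Nat.find_spec (hex n), fun n hn => ?_⟩
  obtain ⟨j, hj⟩ : ∃ j, Nat.find (hex n) = j + 1 := Nat.exists_eq_succ_of_ne_zero hn
  have hmin := Nat.find_min (hex n) (m := j) (by omega)
  dsimp only
  rw [hj, pow_succ', ← mul_assoc, ENNReal.mul_inv_cancel two_ne_zero ENNReal.ofNat_ne_top, one_mul]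
  exact le_self_add.trans (not_le.1 hmin).le

/-- For a gauge function that is positive at positive points, Assumption(*) yields a Tukey reduction
of the gauge null ideal to the null ideal of Cantor space. -/
lemma tukeyLE_cantorNull_of_pos {X : Type u} [MetricSpace X] {f : ℝ≥0 → ℝ≥0} (hf : IsGauge f)
    (hpos : ∀ r, 0 < r → 0 < f r) (hstar : AssumptionStar X f) :
    TukeyLE (gaugeNull X f) cantorNull := by
  obtain ⟨α, -, 𝒞, h𝒞, hstar⟩ := hstar
  obtain ⟨C, hCfin, hC⟩ : ∃ C : ℕ → Set X, (∀ n, Metric.ediam (C n) ≠ ⊤) ∧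
      ∀ A : Set X, Metric.ediam A ≠ ⊤ → ∀ ε : ℝ≥0, 0 < ε → ∃ n, A ⊆ C n ∧
        f (Metric.ediam (C n)).toNNReal ≤ ε + α * f (Metric.ediam A).toNNReal := by
    have hne : {C ∈ 𝒞 | Metric.ediam C ≠ ⊤}.Nonempty := by
      obtain ⟨C, hC, -, hfin, -⟩ := hstar ∅ (by simp) 1 one_pos
      exact ⟨C, hC, hfin⟩
    obtain ⟨C, hC⟩ := (h𝒞.mono (Set.sep_subset 𝒞 _)).exists_eq_range hne
    refine ⟨C, fun n => (hC.ge (Set.mem_range_self n)).2, fun A hA ε hε => ?_⟩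
    obtain ⟨D, hD, hAD, hfin, hle⟩ := hstar A hA ε hε
    obtain ⟨n, rfl⟩ : D ∈ Set.range C := hC ▸ ⟨hD, hfin⟩
    exact ⟨n, hAD, hle⟩
  set a : ℕ → ℝ≥0 := fun n => f (Metric.ediam (C n)).toNNReal with ha
  obtain ⟨k, hka, hak⟩ := exists_pow_half_comparable a
  have hφ : ∀ E : Set ℕ, ∑' n : E, (a n : ℝ≥0∞) ≠ ⊤ →
      {x | ∃ᶠ n in atTop, n ∈ E ∧ x ∈ cantorRow n (k n)} ∈ cantorNull := by
    intro E hE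
    change coinMeasure _ = 0
    refine measure_setOfPred_frequently_eq_zero (p := fun n x => n ∈ E ∧ x ∈ cantorRow n (k n)) ?_
    have hle : ∀ n, coinMeasure {x | n ∈ E ∧ x ∈ cantorRow n (k n)} ≤
        E.indicator (fun n => (a n : ℝ≥0∞)) n + 2⁻¹ ^ n := by
      intro n
      by_cases hn : n ∈ E
      · simpa [hn, coinMeasure_cantorRow] using hka n
      · simp [hn]
    refine ne_top_of_le_ne_top ?_ (ENNReal.tsum_le_tsum hle)
    rw [ENNReal.tsum_add, ← tsum_subtype E fun n => (a n : ℝ≥0∞), ENNReal.tsum_geometric]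
    simp [hE]
  have hψ : ∀ B ∈ cantorNull, ∃ D ∈ gaugeNull X f, ∀ E : Set ℕ,
      {x | ∃ᶠ n in atTop, n ∈ E ∧ x ∈ cantorRow n (k n)} ⊆ B →
        {x | (∃ n, a n = 0 ∧ x ∈ C n) ∨ ∃ᶠ n in atTop, n ∈ E ∧ x ∈ C n} ⊆ D := by
    intro B hB
    obtain ⟨𝒮, h𝒮, hsum, hcov⟩ := exists_countable_summable_of_measure_eq_zero
      (fun n => isOpen_cantorRow n (k n)) (iIndepSet_cantorRow k) hB
    have hsum' : ∀ S ∈ 𝒮, ∑' n : S, (a n : ℝ≥0∞) ≠ ⊤ := by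
      intro S hS
      obtain ⟨h1, h2⟩ := hsum S hS
      simp only [coinMeasure_cantorRow] at h1
      refine ne_top_of_le_ne_top (ENNReal.mul_ne_top ENNReal.ofNat_ne_top h1)
        (b := 2 * ∑' n : S, (2⁻¹ : ℝ≥0∞) ^ k n) ?_
      rw [← ENNReal.tsum_mul_left]
      refine ENNReal.tsum_le_tsum fun n => hak n fun h0 => h2 n n.2 ?_
      rw [h0, cantorRow_zero]
    have hzero : (⋃ n ∈ {n | a n = 0}, C n) ∈ gaugeNull X f := by
      refine biUnion_mem_gaugeNull hf (Set.to_countable _) fun n hn => ?_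
      have hn' : f (Metric.ediam (C n)).toNNReal = 0 := hn
      refine gaugeNull_mono (fun x hx => ?_) (setOf_frequently_mem_gaugeNull hf hpos
        (D := fun _ => C n) (fun _ => hCfin n) (by simp [hn']))
      exact Frequently.of_forall fun _ => hx
    have hlim : (⋃ S ∈ 𝒮, {x | ∃ᶠ n in atTop, n ∈ S ∧ x ∈ C n}) ∈ gaugeNull X f :=
      biUnion_mem_gaugeNull hf h𝒮 fun S hS =>
        setOf_frequently_mem_and_mem_gaugeNull hf hpos hCfin (hsum' S hS)
    refine ⟨⋃ i : Bool, cond i (⋃ n ∈ {n | a n = 0}, C n)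
      (⋃ S ∈ 𝒮, {x | ∃ᶠ n in atTop, n ∈ S ∧ x ∈ C n}), ?_, ?_⟩
    · have := biUnion_mem_gaugeNull hf (Set.to_countable (Set.univ : Set Bool))
        (A := fun i => cond i (⋃ n ∈ {n | a n = 0}, C n)
          (⋃ S ∈ 𝒮, {x | ∃ᶠ n in atTop, n ∈ S ∧ x ∈ C n}))
        fun i _ => by cases i <;> assumption
      rwa [Set.biUnion_univ] at this
    · rintro E hE x (⟨n, hn, hx⟩ | hx)
      · exact Set.mem_iUnion.2 ⟨true, Set.mem_biUnion (x := n) hn hx⟩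
      · obtain ⟨S, hS, hES⟩ := hcov E hE
        refine Set.mem_iUnion.2 ⟨false, Set.mem_biUnion (x := S) hS ?_⟩
        exact (Frequently.and_eventually hx hES).mono fun n hn => ⟨hn.2 hn.1.1, hn.1.2⟩
  choose E hE hAE using fun A : gaugeNull X f =>
    exists_subset_frequently_of_mem_gaugeNull hC A.2
  choose ψ hψ hψE using fun B : cantorNull => hψ B B.2
  exact ⟨fun A => ⟨_, hφ (E A) (hE A)⟩, fun B => ⟨ψ B, hψ B⟩, fun A B hAB x hx =>
    hψE B (E A) hAB (hAE A x hx)⟩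

theorem statement5 {X : Type u} [MetricSpace X] [TopologicalSpace.SeparableSpace X]
    (f : ℝ≥0 → ℝ≥0) (hf : IsGauge f) (hstar : AssumptionStar X f) :
    TukeyLE (gaugeNull X f) cantorNull ∧
      WithTop.map Cardinal.lift.{u, 0} (addIdeal cantorNull) ≤ addIdeal (gaugeNull X f) ∧
      cofIdeal (gaugeNull X f) ≤ Cardinal.lift.{u, 0} (cofIdeal cantorNull) := by
  have h : TukeyLE (gaugeNull X f) cantorNull := by
    by_cases hpos : ∀ r, 0 < r → 0 < f r
    · exact tukeyLE_cantorNull_of_pos hf hpos hstar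
    · push Not at hpos
      obtain ⟨r, hr, hfr⟩ := hpos
      have hempty : (∅ : Set (ℕ → Bool)) ∈ cantorNull := measure_empty (μ := coinMeasure)
      exact ⟨fun _ => ⟨∅, hempty⟩,
        fun _ => ⟨Set.univ, univ_mem_gaugeNull hf hr (le_antisymm hfr bot_le)⟩,
        fun _ _ _ => Set.subset_univ _⟩
  exact ⟨h, h.addIdeal_le fun _ _ => gaugeNull_mono, h.cofIdeal_le⟩
end

section
/- For each $n\in\omega$ let $G_n$ be a finite simple graph with nonempty vertex set $V(G_n)$. Let $\Omega=\prod_{n\in\omega}V(G_n)$, with the metric $\rho$ defined for $x\neq y$ as follows: if $n$ is the least index with $x(n)\neq y(n)$, then $\rho(x,y)=2^{-n+1}$ if $x(n)$ and $y(n)$ are adjacent in $G_n$, and $\rho(x,y)=2^{-n}$ otherwise. A standard set is a set of the form $\prod_{i\in\omega}H_i\subseteq\Omega$ for which there is $j\in\omega$ such that $H_i$ is a singleton for every $i<j$, $H_j$ is a nonempty independent subset of $G_j$, and $H_i=V(G_i)$ for every $i>j$. Then every subset $S\subseteq\Omega$ with $|S|\geq 2$ and diameter at most $1$ is contained in a standard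 set that has the same diameter as $S$. -/
open scoped Classical in
/-- The function `ρ` on `Π n, V n`: for `x ≠ y`, with `n` the first index where `x` and `y` differ,
it is `2 ^ (-n + 1)` if `x n` and `y n` are adjacent in `G n`, and `2 ^ (-n)` otherwise. -/
noncomputable def daviesRogersDist {V : ℕ → Type*} (G : ∀ n, SimpleGraph (V n))
    (x y : ∀ n, V n) : ℝ :=
  if x = y then 0
  else if (G (PiNat.firstDiff x y)).Adj (x (PiNat.firstDiff x y)) (y (PiNat.firstDiff x y)) then
    (2 : ℝ) ^ (-(PiNat.firstDiff x y : ℤ) + 1)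
  else (2 : ℝ) ^ (-(PiNat.firstDiff x y : ℤ))

theorem daviesRogersDist_le {V : ℕ → Type*} (G : ∀ n, SimpleGraph (V n))
    (x y : ∀ n, V n) (n : ℕ) (h : ∀ k < n, x k = y k) :
    daviesRogersDist G x y ≤ (2 : ℝ) ^ (-(n : ℤ) + 1) := by
  unfold daviesRogersDist
  by_cases hxy : x = y
  · rw [if_pos hxy]; positivity
  have hn : n ≤ PiNat.firstDiff x y := by
    by_contra hlt
    exact PiNat.apply_firstDiff_ne hxy (h _ (not_le.1 hlt))
  rw [if_neg hxy]
  split_ifs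
  · exact zpow_le_zpow_right₀ (by norm_num) (by omega)
  · exact zpow_le_zpow_right₀ (by norm_num) (by omega)

theorem daviesRogersDist_ge {V : ℕ → Type*} (G : ∀ n, SimpleGraph (V n))
    (x y : ∀ n, V n) (n : ℕ) (h : x n ≠ y n) :
    (2 : ℝ) ^ (-(n : ℤ)) ≤ daviesRogersDist G x y := by
  unfold daviesRogersDist
  have hxy : x ≠ y := fun e => h (by rw [e])
  have hn : PiNat.firstDiff x y ≤ n := by
    by_contra hlt
    exact h (PiNat.apply_eq_of_lt_firstDiff (not_le.1 hlt))
  rw [if_neg hxy]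
  split_ifs
  · exact zpow_le_zpow_right₀ (by norm_num) (by omega)
  · exact zpow_le_zpow_right₀ (by norm_num) (by omega)

theorem daviesRogersDist_self {V : ℕ → Type*} (G : ∀ n, SimpleGraph (V n))
    (x : ∀ n, V n) : daviesRogersDist G x x = 0 := by
  simp [daviesRogersDist]

theorem daviesRogersDist_comm {V : ℕ → Type*} (G : ∀ n, SimpleGraph (V n))
    (x y : ∀ n, V n) : daviesRogersDist G x y = daviesRogersDist G y x := by
  unfold daviesRogersDist
  rw [PiNat.firstDiff_comm y x]
  by_cases hxy : x = y
  · rw [if_pos hxy, if_pos hxy.symm]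
  · rw [if_neg hxy, if_neg (Ne.symm hxy)]
    congr 1
    exact propext (SimpleGraph.adj_comm _ _ _)

theorem daviesRogersDist_nonneg {V : ℕ → Type*} (G : ∀ n, SimpleGraph (V n))
    (x y : ∀ n, V n) : 0 ≤ daviesRogersDist G x y := by
  unfold daviesRogersDist
  split_ifs <;> positivity

theorem eq_of_daviesRogersDist_eq_zero {V : ℕ → Type*} (G : ∀ n, SimpleGraph (V n))
    {x y : ∀ n, V n} (h : daviesRogersDist G x y = 0) : x = y := by
  by_contra hne
  have h1 := daviesRogersDist_ge G x y _ (PiNat.apply_firstDiff_ne hne)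
  have h2 : (0 : ℝ) < (2 : ℝ) ^ (-(PiNat.firstDiff x y : ℤ)) := by positivity
  linarith

/-- If `x` and `z` agree up to and including the first index where `x` and `y` differ, then `z` is
at the same distance from `y` as `x`. -/
theorem daviesRogersDist_congr {V : ℕ → Type*} (G : ∀ n, SimpleGraph (V n))
    {x y z : ∀ n, V n} (hxy : x ≠ y) (h : ∀ k ≤ PiNat.firstDiff x y, x k = z k) :
    daviesRogersDist G z y = daviesRogersDist G x y := by
  have hne := PiNat.apply_firstDiff_ne hxy
  have hz : z (PiNat.firstDiff x y) ≠ y (PiNat.firstDiff x y) := by rwa [← h _ le_rfl]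
  have hzy : z ≠ y := fun e => hz (by rw [e])
  have hd : PiNat.firstDiff z y = PiNat.firstDiff x y := by
    apply le_antisymm
    · by_contra hlt
      exact hz (PiNat.apply_eq_of_lt_firstDiff (not_le.1 hlt))
    · by_contra hlt
      have hlt := not_le.1 hlt
      apply PiNat.apply_firstDiff_ne hzy
      rw [← h _ hlt.le]
      exact PiNat.apply_eq_of_lt_firstDiff hlt
  unfold daviesRogersDist
  rw [if_neg hxy, if_neg hzy, hd, h _ le_rfl]

theorem daviesRogersDist_triangle {V : ℕ → Type*} (G : ∀ n, SimpleGraph (V n))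
    (x y z : ∀ n, V n) :
    daviesRogersDist G x z ≤ daviesRogersDist G x y + daviesRogersDist G y z := by
  by_cases hxz : x = z
  · subst hxz
    rw [daviesRogersDist_self]
    exact add_nonneg (daviesRogersDist_nonneg ..) (daviesRogersDist_nonneg ..)
  by_cases h1 : ∀ k ≤ PiNat.firstDiff x z, x k = y k
  · rw [daviesRogersDist_congr G hxz h1]
    linarith [daviesRogersDist_nonneg G x y]
  by_cases h2 : ∀ k ≤ PiNat.firstDiff z x, z k = y k
  · rw [daviesRogersDist_comm G x y, daviesRogersDist_congr G (Ne.symm hxz) h2,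
      daviesRogersDist_comm G z x]
    linarith [daviesRogersDist_nonneg G y z]
  rw [PiNat.firstDiff_comm] at h2
  push Not at h1 h2
  obtain ⟨k, hk, hk'⟩ := h1
  obtain ⟨l, hl, hl'⟩ := h2
  have a := daviesRogersDist_le G x z _ (fun i hi => PiNat.apply_eq_of_lt_firstDiff hi)
  have b := daviesRogersDist_ge G x y k hk'
  have c := daviesRogersDist_ge G y z l (Ne.symm hl')
  have b' : (2 : ℝ) ^ (-(PiNat.firstDiff x z : ℤ)) ≤ (2 : ℝ) ^ (-(k : ℤ)) :=
    zpow_le_zpow_right₀ (by norm_num) (by omega)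
  have c' : (2 : ℝ) ^ (-(PiNat.firstDiff x z : ℤ)) ≤ (2 : ℝ) ^ (-(l : ℤ)) :=
    zpow_le_zpow_right₀ (by norm_num) (by omega)
  rw [zpow_add₀ (by norm_num), zpow_one] at a
  linarith

/-- The space `Ω = Π n, V n`, a type synonym that carries the metric `ρ` given by the graphs. -/
def DaviesRogersSpace {V : ℕ → Type*} (_G : ∀ n, SimpleGraph (V n)) : Type _ :=
  ∀ n, V n

noncomputable instance DaviesRogersSpace.instMetricSpace {V : ℕ → Type*}
    (G : ∀ n, SimpleGraph (V n)) : MetricSpace (DaviesRogersSpace G) where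
  dist x y := daviesRogersDist G x y
  dist_self x := daviesRogersDist_self G x
  dist_comm x y := daviesRogersDist_comm G x y
  dist_triangle x y z := daviesRogersDist_triangle G x y z
  eq_of_dist_eq_zero h := eq_of_daviesRogersDist_eq_zero G h

/-- A standard set of rank `j`: a product `Π i, H i` where `H i` is a singleton for `i < j`,
`H j` is a nonempty independent set of `G j`, and `H i` is the full vertex set for `i > j`. -/
def IsStandardSetOfRank {V : ℕ → Type*} (G : ∀ n, SimpleGraph (V n)) (j : ℕ)
    (S : Set (DaviesRogersSpace G)) : Prop :=
  ∃ H : ∀ i, Set (V i),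
    S = {x | ∀ i, x i ∈ H i} ∧
    (∀ i < j, ∃ a : V i, H i = {a}) ∧
    (H j).Nonempty ∧ (G j).IsIndepSet (H j) ∧
    (∀ i > j, H i = Set.univ)

/-- A standard set is a standard set of some rank. -/
def IsStandardSet {V : ℕ → Type*} (G : ∀ n, SimpleGraph (V n))
    (S : Set (DaviesRogersSpace G)) : Prop :=
  ∃ j : ℕ, IsStandardSetOfRank G j S

theorem firstDiff_eq_of_forall_lt {V : ℕ → Type*} {x y : ∀ n, V n} {j : ℕ}
    (h : ∀ k < j, x k = y k) (hj : x j ≠ y j) : PiNat.firstDiff x y = j := by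
  have hxy : x ≠ y := fun e => hj (by rw [e])
  apply le_antisymm
  · by_contra hlt
    exact hj (PiNat.apply_eq_of_lt_firstDiff (not_le.1 hlt))
  · by_contra hlt
    exact PiNat.apply_firstDiff_ne hxy (h _ (not_le.1 hlt))

theorem daviesRogersDist_le_of_not_adj {V : ℕ → Type*} (G : ∀ n, SimpleGraph (V n))
    {x y : ∀ n, V n} (j : ℕ) (h : ∀ k < j, x k = y k) (hj : ¬ (G j).Adj (x j) (y j)) :
    daviesRogersDist G x y ≤ (2 : ℝ) ^ (-(j : ℤ)) := by
  by_cases hxj : x j = y j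
  · have := daviesRogersDist_le G x y (j + 1) fun k hk =>
      (Nat.lt_succ_iff_lt_or_eq.1 hk).elim (h k) fun e => e ▸ hxj
    simpa using this
  · have hxy : x ≠ y := fun e => hxj (by rw [e])
    unfold daviesRogersDist
    rw [if_neg hxy, firstDiff_eq_of_forall_lt h hxj, if_neg hj]

theorem daviesRogersDist_of_adj {V : ℕ → Type*} (G : ∀ n, SimpleGraph (V n))
    {x y : ∀ n, V n} (j : ℕ) (h : ∀ k < j, x k = y k) (hj : (G j).Adj (x j) (y j)) :
    daviesRogersDist G x y = (2 : ℝ) ^ (-(j : ℤ) + 1) := by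
  have hxy : x ≠ y := fun e => hj.ne (by rw [e])
  unfold daviesRogersDist
  rw [if_neg hxy, firstDiff_eq_of_forall_lt h hj.ne, if_pos hj]

/-- A standard set of rank `j` has diameter at most `2 ^ (-j)`. -/
theorem IsStandardSetOfRank.ediam_le {V : ℕ → Type*} {G : ∀ n, SimpleGraph (V n)} {j : ℕ}
    {T : Set (DaviesRogersSpace G)} (hT : IsStandardSetOfRank G j T) :
    Metric.ediam T ≤ ENNReal.ofReal ((2 : ℝ) ^ (-(j : ℤ))) := by
  obtain ⟨H, rfl, hlt, -, hind, -⟩ := hT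
  refine Metric.ediam_le fun x hx y hy => ?_
  rw [edist_dist]
  refine ENNReal.ofReal_le_ofReal (daviesRogersDist_le_of_not_adj G j (fun k hk => ?_) fun hadj => ?_)
  · obtain ⟨a, ha⟩ := hlt k hk
    have h1 := hx k
    have h2 := hy k
    rw [ha] at h1 h2
    exact h1.trans h2.symm
  · exact hind (hx j) (hy j) hadj.ne hadj

/-- The points that agree with `x` below `j` and whose `j`-th coordinate lies in an independent
set form a standard set of rank `j`. -/
theorem isStandardSetOfRank_cylinder {V : ℕ → Type*} (G : ∀ n, SimpleGraph (V n)) (j : ℕ)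
    (x : ∀ n, V n) {I : Set (V j)} (hne : I.Nonempty) (hI : (G j).IsIndepSet I) :
    IsStandardSetOfRank G j {y | (∀ k < j, y k = x k) ∧ y j ∈ I} := by
  refine ⟨fun i => {v | (i < j → v = x i) ∧ ∀ e : i = j, e ▸ v ∈ I}, ?_, ?_, ?_, ?_, ?_⟩
  · ext y
    constructor
    · rintro ⟨h1, h2⟩ i
      exact ⟨h1 i, by rintro rfl; exact h2⟩
    · intro h
      exact ⟨fun k hk => (h k).1 hk, (h j).2 rfl⟩
  · intro i hi
    refine ⟨x i, Set.ext fun v => ⟨fun h => h.1 hi, fun h => ⟨fun _ => h, fun e => ?_⟩⟩⟩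
    exact absurd e hi.ne
  · obtain ⟨v, hv⟩ := hne
    exact ⟨v, fun h => absurd h (lt_irrefl j), fun _ => hv⟩
  · exact hI.mono fun v hv => hv.2 rfl
  · intro i hi
    exact Set.eq_univ_of_forall fun v => ⟨fun h => absurd h hi.not_gt, fun e => absurd e hi.ne'⟩

theorem statement11
    {V : ℕ → Type*} [∀ n, Finite (V n)] [∀ n, Nonempty (V n)]
    (G : ∀ n, SimpleGraph (V n))
    (S : Set (DaviesRogersSpace G)) (hS : S.Nontrivial) (hdiam : Metric.ediam S ≤ 1) :
    ∃ T : Set (DaviesRogersSpace G),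
      IsStandardSet G T ∧ S ⊆ T ∧ Metric.ediam T = Metric.ediam S := by
  classical
  suffices h : ∃ (j : ℕ) (T : Set (DaviesRogersSpace G)), IsStandardSetOfRank G j T ∧ S ⊆ T ∧
      ∃ x ∈ S, ∃ y ∈ S, (2 : ℝ) ^ (-(j : ℤ)) ≤ daviesRogersDist G x y by
    obtain ⟨j, T, hT, hST, x, hx, y, hy, hxy⟩ := h
    refine ⟨T, ⟨j, hT⟩, hST, le_antisymm (hT.ediam_le.trans ?_) (Metric.ediam_mono hST)⟩
    refine le_trans ?_ (Metric.edist_le_ediam_of_mem hx hy)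
    rw [edist_dist]
    exact ENNReal.ofReal_le_ofReal hxy
  have hex : ∃ m, ∃ x ∈ S, ∃ y ∈ S, x m ≠ y m := by
    obtain ⟨x, hx, y, hy, hxy⟩ := hS
    exact ⟨_, x, hx, y, hy, PiNat.apply_firstDiff_ne hxy⟩
  obtain ⟨m, ⟨a, ha, b, hb, hab⟩, hmin⟩ :
      ∃ m, (∃ x ∈ S, ∃ y ∈ S, x m ≠ y m) ∧ ∀ k < m, ∀ x ∈ S, ∀ y ∈ S, x k = y k := by
    refine ⟨Nat.find hex, Nat.find_spec hex, fun k hk => ?_⟩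
    have := Nat.find_min hex hk
    push Not at this
    exact this
  by_cases hind : (G m).IsIndepSet ((fun x : DaviesRogersSpace G => x m) '' S)
  · exact ⟨m, _, isStandardSetOfRank_cylinder G m a (Set.Nonempty.image _ ⟨a, ha⟩) hind,
      fun y hy => ⟨fun k hk => hmin k hk y hy a ha, y, hy, rfl⟩,
      a, ha, b, hb, daviesRogersDist_ge G a b m hab⟩
  · obtain ⟨x, hx, y, hy, hadj⟩ : ∃ x ∈ S, ∃ y ∈ S, (G m).Adj (x m) (y m) := by
      by_contra! hno
      refine hind ?_
      rintro _ ⟨x, hx, rfl⟩ _ ⟨y, hy, rfl⟩ -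
      exact hno x hx y hy
    have hdist := daviesRogersDist_of_adj G m (fun k hk => hmin k hk x hx y hy) hadj
    have hle : daviesRogersDist G x y ≤ 1 := by
      have := (Metric.edist_le_ediam_of_mem hx hy).trans hdiam
      rw [edist_dist, ← ENNReal.ofReal_one, ENNReal.ofReal_le_ofReal_iff zero_le_one] at this
      exact this
    cases m with
    | zero => norm_num [hdist] at hle
    | succ j =>
      exact ⟨j, _, isStandardSetOfRank_cylinder G j a (Set.singleton_nonempty (a j))
          (Set.pairwise_singleton _ _),
        fun z hz => ⟨fun k hk => hmin k (by omega) z hz a ha, hmin j (by omega) z hz a ha⟩,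
        x, hx, y, hy, by rw [hdist]; push_cast; simp⟩
end
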